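/- Let ρ and ρ′ be Hermitian 8×8 complex matrices with coefficient tensors x and x′ respectively. Suppose there exist O₁, O₂, O₃ ∈ SO(3) such that, denoting by Õᵢ the padded 4×4 matrix of Oᵢ, one has x′_{k l m} = Σ_{p,q,r=0}^{3} (Õ₁)_{k p}·(Õ₂)_{l q}·(Õ₃)_{m r}·x_{p q r} for all k, l, m ∈ {0,1,2,3}. Then there exist U₁, U₂, U₃ ∈ SU(2) such that ρ′ = (U₁ ⊗ U₂ ⊗ U₃)·ρ·(U₁ ⊗ U₂ ⊗ U₃)ᴴ, where ⊗ is the Kronecker product. -/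

import Mathlib

open Matrix Kronecker

/-- The Pauli matrices `σ₀ = I₂, σ₁, σ₂, σ₃`. -/
noncomputable def pauli : Fin 4 → Matrix (Fin 2) (Fin 2) ℂ
  | 0 => 1
  | 1 => !![0, 1; 1, 0]
  | 2 => !![0, -Complex.I; Complex.I, 0]
  | 3 => !![1, 0; 0, -1]

/-- The coefficient tensor of a 3-qubit density-like matrix `ρ`:
`x_{i₁ i₂ i₃} = (1/8) Re (Tr (ρ (σ_{i₁} ⊗ σ_{i₂} ⊗ σ_{i₃})))`. -/
noncomputable def coeffTensor
    (ρ : Matrix ((Fin 2 × Fin 2) × Fin 2) ((Fin 2 × Fin 2) × Fin 2) ℂ) :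
    Fin 4 → Fin 4 → Fin 4 → ℝ :=
  fun i₁ i₂ i₃ => (1 / 8) * ((ρ * ((pauli i₁ ⊗ₖ pauli i₂) ⊗ₖ pauli i₃)).trace).re

/-- The padded `4 × 4` matrix of a `3 × 3` matrix `O`: a `1` in the `(0,0)`
entry, zeros in the remaining first row and column, and `O` in the lower-right
`3 × 3` block. -/
def padded (O : Matrix (Fin 3) (Fin 3) ℝ) : Matrix (Fin 4) (Fin 4) ℝ :=
  Matrix.of fun i j =>
    if i = 0 then (if j = 0 then 1 else 0)
    else if j = 0 then 0
    else O ⟨i.1 - 1, by have := i.isLt; omega⟩ ⟨j.1 - 1, by have := j.isLt; omega⟩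


theorem quat_exists (O : Matrix (Fin 3) (Fin 3) ℝ) (h : Oᵀ * O = 1) (hd : O.det = 1) :
    ∃ a b c d : ℝ, a^2+b^2+c^2+d^2 = 1 ∧
      O = !![a^2+b^2-c^2-d^2, 2*(b*c-a*d), 2*(b*d+a*c);
             2*(b*c+a*d), a^2-b^2+c^2-d^2, 2*(c*d-a*b);
             2*(b*d-a*c), 2*(c*d+a*b), a^2-b^2-c^2+d^2] := by
  have h' : O * Oᵀ = 1 := mul_eq_one_comm.mp h
  have hadj : O.adjugate = Oᵀ := by
    have h1 : O * O.adjugate = 1 := by rw [Matrix.mul_adjugate, hd, one_smul]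
    calc O.adjugate = (Oᵀ * O) * O.adjugate := by rw [h, one_mul]
      _ = Oᵀ := by rw [Matrix.mul_assoc, h1, mul_one]
  have e1 := fun i j => congrFun (congrFun h i) j
  have e2 := fun i j => congrFun (congrFun h' i) j
  have e3 := fun i j => congrFun (congrFun hadj i) j
  rw [Matrix.adjugate_fin_three] at e3
  simp [Matrix.mul_apply, Fin.sum_univ_three, Fin.forall_fin_succ, Matrix.one_apply] at e1 e2 e3
  have hO := Matrix.eta_fin_three O
  generalize O 0 0 = p at *
  generalize O 0 1 = q at *
  generalize O 0 2 = r at *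
  generalize O 1 0 = s at *
  generalize O 1 1 = t at *
  generalize O 1 2 = u at *
  generalize O 2 0 = v at *
  generalize O 2 1 = w at *
  generalize O 2 2 = x at *
  obtain ⟨⟨a1,a2,a3⟩,⟨a4,a5,a6⟩,a7,a8,a9⟩ := e1
  obtain ⟨⟨b1,b2,b3⟩,⟨b4,b5,b6⟩,b7,b8,b9⟩ := e2
  obtain ⟨⟨c1,c2,c3⟩,⟨c4,c5,c6⟩,c7,c8,c9⟩ := e3
  have key : ∀ K : Matrix (Fin 4) (Fin 4) ℝ, K = !![1+p+t+x, w-u, r-v, s-q;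
      w-u, 1+p-t-x, q+s, r+v; r-v, q+s, 1-p+t-x, u+w; s-q, r+v, u+w, 1-p-t+x] →
      ∀ i j k, K i i * K j k = K i j * K i k := by
    rintro K rfl i j k
    fin_cases i <;> fin_cases j <;> fin_cases k <;> simp <;> linarith
  have := key _ rfl
  set K : Matrix (Fin 4) (Fin 4) ℝ := !![1+p+t+x, w-u, r-v, s-q;
      w-u, 1+p-t-x, q+s, r+v; r-v, q+s, 1-p+t-x, u+w; s-q, r+v, u+w, 1-p-t+x] with hK
  have hpos : ∃ i, 0 < K i i := by
    by_contra! hc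
    have k0 := hc 0
    have k1 := hc 1
    have k2 := hc 2
    have k3 := hc 3
    simp [hK] at k0 k1 k2 k3
    linarith
  obtain ⟨i, hi⟩ := hpos
  obtain ⟨f, hf⟩ : ∃ f : Fin 4 → ℝ, ∀ j k, f j * f k * 4 = K j k := by
    refine ⟨fun j => K i j / (2 * √(K i i)), fun j k => ?_⟩
    have hs := Real.sq_sqrt hi.le
    have hs0 := (Real.sqrt_pos.mpr hi).ne'
    field_simp
    rw [hs]
    linarith [this i j k]
  clear_value K
  subst hK
  simp [Fin.forall_fin_succ] at hf
  refine ⟨f 0, f 1, f 2, f 3, by linarith, ?_⟩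
  rw [hO]
  congr! <;> linarith

theorem su2_exists (O : Matrix (Fin 3) (Fin 3) ℝ) (h : Oᵀ * O = 1) (hd : O.det = 1) :
    ∃ U : Matrix (Fin 2) (Fin 2) ℂ, U * Uᴴ = 1 ∧ U.det = 1 ∧
      ∀ k, Uᴴ * pauli k * U = ∑ p, (padded O k p : ℂ) • pauli p := by
  obtain ⟨a, b, c, d, hn, rfl⟩ := quat_exists O h hd
  clear h hd
  have hn' : (a:ℂ)^2+b^2+c^2+d^2 = 1 := by exact_mod_cast hn
  have hI := Complex.I_sq
  refine ⟨!![a - d * Complex.I, -c - b * Complex.I; c - b * Complex.I, a + d * Complex.I], ?_, ?_, ?_⟩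
  · ext i j
    fin_cases i <;> fin_cases j <;> simp [Matrix.mul_apply, Fin.sum_univ_two] <;> grind
  · simp [Matrix.det_fin_two]; grind
  · intro k
    fin_cases k <;> ext i j <;> fin_cases i <;> fin_cases j <;>
      simp [Matrix.mul_apply, Fin.sum_univ_two, Fin.sum_univ_four, pauli, padded, Matrix.sum_apply] <;> grind

abbrev M2 := Matrix (Fin 2) (Fin 2) ℂ
abbrev M8 := Matrix ((Fin 2 × Fin 2) × Fin 2) ((Fin 2 × Fin 2) × Fin 2) ℂ

theorem trace_expand (A : M8) (a b c : Fin 4 → ℂ) :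
    (A * (((∑ p, a p • pauli p) ⊗ₖ (∑ p, b p • pauli p)) ⊗ₖ (∑ p, c p • pauli p))).trace =
    ∑ p, ∑ q, ∑ r, a p * b q * c r * (A * ((pauli p ⊗ₖ pauli q) ⊗ₖ pauli r)).trace := by
  have : ((∑ p, a p • pauli p) ⊗ₖ (∑ p, b p • pauli p)) ⊗ₖ (∑ p, c p • pauli p) =
    ∑ p, ∑ q, ∑ r, (a p * b q * c r) • ((pauli p ⊗ₖ pauli q) ⊗ₖ pauli r) := by
    ext i j
    simp only [Matrix.kroneckerMap_apply, Matrix.sum_apply, Matrix.smul_apply, smul_eq_mul]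
    rw [Finset.sum_mul_sum, Finset.sum_mul]
    refine Finset.sum_congr rfl fun p _ => ?_
    rw [Finset.sum_mul_sum]
    refine Finset.sum_congr rfl fun q _ => Finset.sum_congr rfl fun r _ => ?_
    ring
  rw [this]
  simp only [Finset.mul_sum, Matrix.trace_sum, Matrix.mul_smul, Matrix.trace_smul, smul_eq_mul]

theorem pauli_herm (k : Fin 4) : (pauli k)ᴴ = pauli k := by
  fin_cases k <;> ext i j <;> fin_cases i <;> fin_cases j <;> simp [pauli]

theorem pauli_span (M : M2) : ∃ a : Fin 4 → ℂ, M = ∑ p, a p • pauli p := by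
  refine ⟨![(M 0 0 + M 1 1)/2, (M 0 1 + M 1 0)/2, (M 0 1 - M 1 0)/2 * Complex.I, (M 0 0 - M 1 1)/2], ?_⟩
  have hI := Complex.I_sq
  ext i j
  fin_cases i <;> fin_cases j <;>
    simp [Fin.sum_univ_four, pauli, Matrix.sum_apply] <;> grind

theorem trace_eq_coeff (A : M8) (hA : A.IsHermitian) (p q r : Fin 4) :
    (A * ((pauli p ⊗ₖ pauli q) ⊗ₖ pauli r)).trace = ((8 * coeffTensor A p q r : ℝ) : ℂ) := by
  have h8 : 8 * coeffTensor A p q r = ((A * ((pauli p ⊗ₖ pauli q) ⊗ₖ pauli r)).trace).re := by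
    unfold coeffTensor; ring
  rw [h8]
  symm
  rw [← Complex.conj_eq_iff_re]
  change star _ = _
  rw [← Matrix.trace_conjTranspose, Matrix.conjTranspose_mul, hA.eq,
    Matrix.conjTranspose_kronecker, Matrix.conjTranspose_kronecker, pauli_herm, pauli_herm,
    pauli_herm, Matrix.trace_mul_comm]

theorem coeff_inj (A B : M8) (hA : A.IsHermitian) (hB : B.IsHermitian)
    (h : ∀ p q r, coeffTensor A p q r = coeffTensor B p q r) : A = B := by
  have H : ∀ M N P : M2, (A * ((M ⊗ₖ N) ⊗ₖ P)).trace = (B * ((M ⊗ₖ N) ⊗ₖ P)).trace := by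
    intro M N P
    obtain ⟨a, rfl⟩ := pauli_span M
    obtain ⟨b, rfl⟩ := pauli_span N
    obtain ⟨c, rfl⟩ := pauli_span P
    rw [trace_expand, trace_expand]
    simp only [trace_eq_coeff A hA, trace_eq_coeff B hB, h]
  ext ⟨⟨i, j⟩, k⟩ ⟨⟨i', j'⟩, k'⟩
  have := H (Matrix.single i' i 1) (Matrix.single j' j 1) (Matrix.single k' k 1)
  simpa [Matrix.single_kronecker_single, Matrix.trace_mul_single] using this

/-- If the coefficient tensors of two Hermitian 8×8 matrices are related by
`(Õ₁ ⊗ Õ₂ ⊗ Õ₃)` for some `O₁, O₂, O₃ ∈ SO(3)`, then the matrices are related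
by a local special unitary `U₁ ⊗ U₂ ⊗ U₃`. -/
theorem local_unitary_of_coeffTensor
    (ρ ρ' : Matrix ((Fin 2 × Fin 2) × Fin 2) ((Fin 2 × Fin 2) × Fin 2) ℂ)
    (hρ : ρ.IsHermitian) (hρ' : ρ'.IsHermitian)
    (h : ∃ O₁ O₂ O₃ : Matrix (Fin 3) (Fin 3) ℝ,
      O₁ᵀ * O₁ = 1 ∧ O₁.det = 1 ∧
      O₂ᵀ * O₂ = 1 ∧ O₂.det = 1 ∧
      O₃ᵀ * O₃ = 1 ∧ O₃.det = 1 ∧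
      ∀ k l m : Fin 4, coeffTensor ρ' k l m =
        ∑ p : Fin 4, ∑ q : Fin 4, ∑ r : Fin 4,
          padded O₁ k p * padded O₂ l q * padded O₃ m r * coeffTensor ρ p q r) :
    ∃ U₁ U₂ U₃ : Matrix (Fin 2) (Fin 2) ℂ,
      U₁ * U₁ᴴ = 1 ∧ U₁.det = 1 ∧
      U₂ * U₂ᴴ = 1 ∧ U₂.det = 1 ∧
      U₃ * U₃ᴴ = 1 ∧ U₃.det = 1 ∧
      ρ' = ((U₁ ⊗ₖ U₂) ⊗ₖ U₃) * ρ * ((U₁ ⊗ₖ U₂) ⊗ₖ U₃)ᴴ := by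
  obtain ⟨O₁, O₂, O₃, h1, d1, h2, d2, h3, d3, hx⟩ := h
  obtain ⟨U₁, u1, e1, k1⟩ := su2_exists O₁ h1 d1
  obtain ⟨U₂, u2, e2, k2⟩ := su2_exists O₂ h2 d2
  obtain ⟨U₃, u3, e3, k3⟩ := su2_exists O₃ h3 d3
  refine ⟨U₁, U₂, U₃, u1, e1, u2, e2, u3, e3, ?_⟩
  have hH : (((U₁ ⊗ₖ U₂) ⊗ₖ U₃) * ρ * ((U₁ ⊗ₖ U₂) ⊗ₖ U₃)ᴴ).IsHermitian :=
    Matrix.isHermitian_mul_mul_conjTranspose _ hρ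
  refine coeff_inj _ _ hρ' hH fun k l m => ?_
  have hc : ((8 * coeffTensor (((U₁ ⊗ₖ U₂) ⊗ₖ U₃) * ρ * ((U₁ ⊗ₖ U₂) ⊗ₖ U₃)ᴴ) k l m : ℝ) : ℂ)
      = ((8 * coeffTensor ρ' k l m : ℝ) : ℂ) := by
    rw [← trace_eq_coeff _ hH, hx]
    have : (((U₁ ⊗ₖ U₂) ⊗ₖ U₃) * ρ * ((U₁ ⊗ₖ U₂) ⊗ₖ U₃)ᴴ *
        ((pauli k ⊗ₖ pauli l) ⊗ₖ pauli m)).trace =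
        (ρ * (((U₁ᴴ * pauli k * U₁) ⊗ₖ (U₂ᴴ * pauli l * U₂)) ⊗ₖ (U₃ᴴ * pauli m * U₃))).trace := by
      simp only [Matrix.mul_kronecker_mul, Matrix.conjTranspose_kronecker]
      rw [Matrix.mul_assoc, Matrix.mul_assoc, Matrix.trace_mul_comm]
      simp only [Matrix.mul_assoc]
    rw [this, k1, k2, k3, trace_expand]
    simp only [trace_eq_coeff ρ hρ]
    push_cast
    simp only [Finset.mul_sum]
    refine Finset.sum_congr rfl fun p _ => Finset.sum_congr rfl fun q _ => Finset.sum_congr rfl fun r _ => ?_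
    ring
  have := Complex.ofReal_injective hc
  linarith
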